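/- Let M, m be positive integers, let W and Q be real M×M matrices, let X, Z, G, H, P, D be real M×m matrices (D playing the role of the stacked gradients ∇F), and let μ ≠ 0, ρ ≠ 0, α ∈ ℝ, and γ ≠ 1 be real scalars. Suppose the fixed-point equations hold: Z = X − W·X − μ(D − G); α(H − G) + ρ(D − G + (1/μ)(Z − X)) = 0; Q·P = (γ−1)·G; and Q·P = (γ−1)·H. Then: (a) H = G; (b) G = D + (1/μ)(Z − X); (c) W·X = 0; and (d) if in addition Q has zero column sums (𝟙ᵀQ = 0ᵀ, where 𝟙 is the all-ones vector in ℝ^M), then 𝟙ᵀG = 0ᵀ, i.e. the columns of G sum to zero. -/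

import Mathlib

open Matrix Finset

/-- Fixed-point analysis of ASY-DAGP: any fixed point satisfies `H = G`,
`G = ∇F + (1/μ)(Z − X)`, `W·X = 0`, and (if `Q` has zero column sums) `𝟙ᵀG = 0ᵀ`. -/
theorem asy_dagp_fixed_point
    (M m : ℕ) (hM : 0 < M) (hm : 0 < m)
    (W Q : Matrix (Fin M) (Fin M) ℝ)
    (X Z G H P D : Matrix (Fin M) (Fin m) ℝ)
    (μ ρ α γ : ℝ) (hμ : μ ≠ 0) (hρ : ρ ≠ 0) (hγ : γ ≠ 1)
    (hz : Z = X - W * X - μ • (D - G))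
    (hg : α • (H - G) + ρ • (D - G + μ⁻¹ • (Z - X)) = 0)
    (hp : Q * P = (γ - 1) • G)
    (hh : Q * P = (γ - 1) • H) :
    H = G ∧
    G = D + μ⁻¹ • (Z - X) ∧
    W * X = 0 ∧
    ((∀ j : Fin M, ∑ i : Fin M, Q i j = 0) →
      ∀ j : Fin m, ∑ i : Fin M, G i j = 0) := by
  have hγ' : γ - 1 ≠ 0 := sub_ne_zero.mpr hγ
  have hHG : H = G := smul_right_injective _ hγ' (hh.symm.trans hp)
  have hres : D - G + μ⁻¹ • (Z - X) = 0 := by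
    rwa [hHG, sub_self, smul_zero, zero_add, smul_eq_zero_iff_right hρ] at hg
  have hG : G = D + μ⁻¹ • (Z - X) := by
    rw [← sub_eq_zero, ← neg_eq_zero, ← hres]
    abel
  have hμres : μ • (D - G) + (Z - X) = 0 := by
    simpa [smul_add, smul_smul, hμ] using congrArg (μ • ·) hres
  refine ⟨hHG, hG, ?_, fun hQ j => ?_⟩
  · rw [← neg_eq_zero, ← hμres, hz]
    abel
  · have hone : (1 : Fin M → ℝ) ᵥ* Q = 0 := by
      ext k
      simpa [vecMul, dotProduct] using hQ k
    have hsum : (1 : Fin M → ℝ) ᵥ* ((γ - 1) • G) = 0 := by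
      rw [← hp, ← vecMul_vecMul, hone, zero_vecMul]
    rw [vecMul_smul, smul_eq_zero_iff_right hγ'] at hsum
    simpa [vecMul, dotProduct] using congrFun hsum j
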